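/- Let μ₀ be the unique maximizer of I(μ) over Λ(γ,q), where 0 < q < 1 and γ > 0, and let S_{μ₀} denote its set of points of increase (x ∈ S_{μ₀} iff μ₀(O) > 0 for every open set O containing x). Then S_{μ₀} is countably infinite, while the intersection of S_{μ₀} with every bounded interval of ℝ is a finite set; consequently μ₀ is a discrete measure with infinitely many probability mass points. -/

import Mathlib

open MeasureTheory Real Filter

/-- The standard Gaussian density `φ(t) = (2π)^{-1/2} e^{-t²/2}`. -/
noncomputable def gauss (t : ℝ) : ℝ := Real.exp (-t ^ 2 / 2) / Real.sqrt (2 * Real.pi)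

/-- The output density `p_Y(y;μ) = ∫ φ(y−x) dμ(x)`. -/
noncomputable def outDen (μ : Measure ℝ) (y : ℝ) : ℝ := ∫ x, gauss (y - x) ∂μ

/-- The relative entropy `d(x;μ) = ∫ φ(y−x) log(φ(y−x)/p_Y(y;μ)) dy`. -/
noncomputable def relEnt (x : ℝ) (μ : Measure ℝ) : ℝ :=
  ∫ y, gauss (y - x) * Real.log (gauss (y - x) / outDen μ y)

/-- The mutual information `I(μ) = ∫ d(x;μ) dμ(x)`. -/
noncomputable def mutInfo (μ : Measure ℝ) : ℝ := ∫ x, relEnt x μ ∂μ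

/-- The constraint set `Λ(γ,q)`: probability measures with `μ({0}) ≥ q` and second moment
at most `γ`. -/
def memLam (γ q : ℝ) (μ : Measure ℝ) : Prop :=
  IsProbabilityMeasure μ ∧ ENNReal.ofReal q ≤ μ {0} ∧
    ∫⁻ x, ENNReal.ofReal (x ^ 2) ∂μ ≤ ENNReal.ofReal γ

/-- The set of points of increase of `μ`: `x` such that every open set containing `x` has
positive measure. -/
def ptsIncrease (μ : Measure ℝ) : Set ℝ := {x : ℝ | ∀ O : Set ℝ, IsOpen O → x ∈ O → 0 < μ O}

/-! ### Basic facts on the Gaussian kernel -/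

lemma gauss_pos (t : ℝ) : 0 < gauss t := by unfold gauss; positivity

lemma gauss_cont : Continuous gauss := by unfold gauss; fun_prop

lemma gauss_eq_pdf (x y : ℝ) : gauss (y - x) = ProbabilityTheory.gaussianPDFReal x 1 y := by
  simp [gauss, ProbabilityTheory.gaussianPDFReal, div_eq_inv_mul]

lemma log_gauss (t : ℝ) : Real.log (gauss t) = -t ^ 2 / 2 - Real.log (Real.sqrt (2 * Real.pi)) := by
  unfold gauss
  rw [Real.log_div (by positivity) (by positivity), Real.log_exp]

lemma log_sqrt_nonneg : 0 ≤ Real.log (Real.sqrt (2 * Real.pi)) := by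
  apply Real.log_nonneg
  rw [Real.one_le_sqrt]
  nlinarith [Real.pi_gt_three]

lemma gauss_le_one (t : ℝ) : gauss t ≤ 1 := by
  have h := log_gauss t
  have h2 : Real.log (gauss t) ≤ 0 := by
    rw [h]; nlinarith [log_sqrt_nonneg, sq_nonneg t]
  rw [← Real.log_one] at h2
  exact (Real.log_le_log_iff (gauss_pos t) one_pos).1 h2

lemma gauss_integrable (x : ℝ) : Integrable (fun y => gauss (y - x)) := by
  simp_rw [gauss_eq_pdf]
  exact ProbabilityTheory.integrable_gaussianPDFReal x 1

lemma gauss_integral (x : ℝ) : ∫ y, gauss (y - x) = 1 := by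
  simp_rw [gauss_eq_pdf]
  exact ProbabilityTheory.integral_gaussianPDFReal_eq_one x one_ne_zero

lemma gauss_int_iff (x : ℝ) (f : ℝ → ℝ) :
    Integrable f (ProbabilityTheory.gaussianReal x 1) ↔
      Integrable (fun y => gauss (y - x) * f y) := by
  rw [ProbabilityTheory.gaussianReal_of_var_ne_zero _ one_ne_zero,
    integrable_withDensity_iff_integrable_smul' (ProbabilityTheory.measurable_gaussianPDF x 1)
      (ae_of_all _ fun _ => ProbabilityTheory.gaussianPDF_lt_top)]
  simp [gauss_eq_pdf, ProbabilityTheory.toReal_gaussianPDF]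

lemma gauss_int_eq (x : ℝ) (f : ℝ → ℝ) :
    ∫ y, f y ∂(ProbabilityTheory.gaussianReal x 1) = ∫ y, gauss (y - x) * f y := by
  rw [ProbabilityTheory.integral_gaussianReal_eq_integral_smul one_ne_zero]
  simp [gauss_eq_pdf]

lemma gauss_sq_integrable (x : ℝ) : Integrable (fun y => gauss (y - x) * y ^ 2) := by
  rw [← gauss_int_iff x (fun y => y ^ 2)]
  exact (ProbabilityTheory.memLp_id_gaussianReal' 2 (by simp)).integrable_sq

lemma gauss_sq_integral (x : ℝ) : ∫ y, gauss (y - x) * y ^ 2 = 1 + x ^ 2 := by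
  rw [← gauss_int_eq x (fun y => y ^ 2)]
  have h := ProbabilityTheory.variance_eq_sub
    (ProbabilityTheory.memLp_id_gaussianReal' (μ := x) (v := 1) 2 (by simp))
  rw [ProbabilityTheory.variance_id_gaussianReal] at h
  simp at h
  linarith

/-! ### Functions of quadratic growth -/

/-- continuous, at most quadratic growth -/
def QG (u : ℝ → ℝ) : Prop := Continuous u ∧ ∃ A B : ℝ, ∀ y, |u y| ≤ A + B * y ^ 2

lemma quad_integrable (A B x : ℝ) : Integrable (fun y => gauss (y - x) * (A + B * y ^ 2)) := by
  have : (fun y => gauss (y - x) * (A + B * y ^ 2)) =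
      fun y => gauss (y - x) * A + B * (gauss (y - x) * y ^ 2) := by ext; ring
  rw [this]
  exact ((gauss_integrable x).mul_const A).add ((gauss_sq_integrable x).const_mul B)

lemma quad_integral (A B x : ℝ) :
    ∫ y, gauss (y - x) * (A + B * y ^ 2) = A + B * (1 + x ^ 2) := by
  have : (fun y => gauss (y - x) * (A + B * y ^ 2)) =
      fun y => gauss (y - x) * A + B * (gauss (y - x) * y ^ 2) := by ext; ring
  rw [this, integral_add ((gauss_integrable x).mul_const A) ((gauss_sq_integrable x).const_mul B),
    integral_mul_const, integral_const_mul, gauss_integral, gauss_sq_integral]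
  ring

lemma QG.integrable {u : ℝ → ℝ} (hu : QG u) (x : ℝ) : Integrable (fun y => gauss (y - x) * u y) := by
  obtain ⟨hc, A, B, h⟩ := hu
  refine (quad_integrable A B x).mono' ?_ ?_
  · exact ((gauss_cont.comp (by fun_prop)).mul hc).aestronglyMeasurable
  · refine ae_of_all _ fun y => ?_
    rw [norm_mul, Real.norm_eq_abs, Real.norm_eq_abs, abs_of_pos (gauss_pos _)]
    exact mul_le_mul_of_nonneg_left (h y) (gauss_pos _).le

lemma QG.prod_integrable {u : ℝ → ℝ} (hu : QG u) (ν : Measure ℝ) [IsFiniteMeasure ν]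
    (hν : Integrable (fun x => x ^ 2) ν) :
    Integrable (Function.uncurry fun x y => gauss (y - x) * u y) (ν.prod volume) := by
  obtain ⟨hc, A, B, h⟩ := id hu
  have hm : AEStronglyMeasurable (Function.uncurry fun x y => gauss (y - x) * u y)
      (ν.prod volume) := by
    apply Continuous.aestronglyMeasurable
    unfold Function.uncurry
    exact (gauss_cont.comp (by fun_prop)).mul (hc.comp (by fun_prop))
  rw [integrable_prod_iff hm]
  refine ⟨ae_of_all _ fun x => hu.integrable x, ?_⟩
  have hi : Integrable (fun x : ℝ => A + B * (1 + x ^ 2)) ν :=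
    (integrable_const _).add (((integrable_const _).add hν).const_mul B)
  refine hi.mono' hm.norm.integral_prod_right' (ae_of_all _ fun x => ?_)
  rw [Real.norm_of_nonneg (integral_nonneg fun y => norm_nonneg _), ← quad_integral]
  refine integral_mono (hu.integrable x).norm (quad_integrable A B x) fun y => ?_
  simp only [Function.uncurry]
  rw [norm_mul, Real.norm_eq_abs, Real.norm_eq_abs, abs_of_pos (gauss_pos _)]
  exact mul_le_mul_of_nonneg_left (h y) (gauss_pos _).le

/-- Gaussian smoothing -/
noncomputable def smo (u : ℝ → ℝ) (x : ℝ) : ℝ := ∫ y, gauss (y - x) * u y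

lemma QG.smo_integrable {u : ℝ → ℝ} (hu : QG u) (ν : Measure ℝ) [IsFiniteMeasure ν]
    (hν : Integrable (fun x => x ^ 2) ν) : Integrable (smo u) ν :=
  (hu.prod_integrable ν hν).integral_prod_left

lemma QG.out_integrable {u : ℝ → ℝ} (hu : QG u) (ν : Measure ℝ) [IsFiniteMeasure ν]
    (hν : Integrable (fun x => x ^ 2) ν) : Integrable (fun y => outDen ν y * u y) := by
  have := (hu.prod_integrable ν hν).integral_prod_right
  simpa [Function.uncurry, integral_mul_const, outDen] using this

lemma QG.smo_integral {u : ℝ → ℝ} (hu : QG u) (ν : Measure ℝ) [IsFiniteMeasure ν]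
    (hν : Integrable (fun x => x ^ 2) ν) : ∫ x, smo u x ∂ν = ∫ y, outDen ν y * u y := by
  have := integral_integral_swap (hu.prod_integrable ν hν)
  simpa [Function.uncurry, integral_mul_const, outDen, smo] using this

/-! ### The output density -/

lemma gauss_int_x (μ : Measure ℝ) [IsFiniteMeasure μ] (y : ℝ) :
    Integrable (fun x => gauss (y - x)) μ := by
  refine (integrable_const (1 : ℝ)).mono' ?_ (ae_of_all _ fun x => ?_)
  · exact (gauss_cont.comp (by fun_prop)).aestronglyMeasurable
  · rw [Real.norm_of_nonneg (gauss_pos _).le]; exact gauss_le_one _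

lemma outDen_cont (μ : Measure ℝ) [IsFiniteMeasure μ] : Continuous (outDen μ) := by
  unfold outDen
  refine continuous_of_dominated (bound := fun _ => (1 : ℝ)) (fun y => ?_) (fun y => ?_)
    (integrable_const _) (ae_of_all _ fun x => gauss_cont.comp (by fun_prop))
  · exact (gauss_cont.comp (by fun_prop)).aestronglyMeasurable
  · refine ae_of_all _ fun x => ?_
    rw [Real.norm_of_nonneg (gauss_pos _).le]; exact gauss_le_one _

lemma outDen_le_one (μ : Measure ℝ) [IsProbabilityMeasure μ] (y : ℝ) : outDen μ y ≤ 1 := by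
  have := integral_mono (gauss_int_x μ y) (integrable_const (1 : ℝ)) fun x => gauss_le_one (y - x)
  simpa [outDen] using this

/-- Real form of the constraint. -/
structure Adm (γ q : ℝ) (μ : Measure ℝ) : Prop where
  prob : IsProbabilityMeasure μ
  atom : q ≤ μ.real {0}
  int : Integrable (fun x : ℝ => x ^ 2) μ
  pow : ∫ x, x ^ 2 ∂μ ≤ γ

lemma adm_iff {γ q : ℝ} (hγ : 0 < γ) (μ : Measure ℝ) : memLam γ q μ ↔ Adm γ q μ := by
  constructor
  · rintro ⟨h1, h2, h3⟩
    have hi : Integrable (fun x : ℝ => x ^ 2) μ := by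
      refine ⟨by fun_prop, ?_⟩
      rw [hasFiniteIntegral_iff_ofReal (ae_of_all _ fun x => sq_nonneg x)]
      exact h3.trans_lt ENNReal.ofReal_lt_top
    refine ⟨h1, ?_, hi, ?_⟩
    · exact (ENNReal.ofReal_le_iff_le_toReal (measure_ne_top _ _)).1 h2
    · rw [← ofReal_integral_eq_lintegral_ofReal hi (ae_of_all _ fun x => sq_nonneg x)] at h3
      exact (ENNReal.ofReal_le_ofReal_iff hγ.le).1 h3
  · rintro ⟨h1, h2, h3, h4⟩
    refine ⟨h1, (ENNReal.ofReal_le_iff_le_toReal (measure_ne_top _ _)).2 h2, ?_⟩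
    rw [← ofReal_integral_eq_lintegral_ofReal h3 (ae_of_all _ fun x => sq_nonneg x)]
    exact ENNReal.ofReal_le_ofReal h4

lemma outDen_ge {γ q : ℝ} {μ : Measure ℝ} (h : Adm γ q μ) (y : ℝ) : q * gauss y ≤ outDen μ y := by
  have := h.prob
  have h1 : ∫ x in {0}, gauss (y - x) ∂μ ≤ outDen μ y :=
    setIntegral_le_integral (gauss_int_x μ y) (ae_of_all _ fun x => (gauss_pos _).le)
  rw [integral_singleton] at h1
  simp at h1
  exact (mul_le_mul_of_nonneg_right h.atom (gauss_pos y).le).trans h1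

lemma outDen_pos {γ q : ℝ} (hq : 0 < q) {μ : Measure ℝ} (h : Adm γ q μ) (y : ℝ) :
    0 < outDen μ y := (mul_pos hq (gauss_pos y)).trans_le (outDen_ge h y)

/-- minus log of the output density -/
noncomputable def nl (μ : Measure ℝ) (y : ℝ) : ℝ := -Real.log (outDen μ y)

lemma nl_nonneg {γ q : ℝ} (hq : 0 < q) {μ : Measure ℝ} (h : Adm γ q μ) (y : ℝ) : 0 ≤ nl μ y := by
  have := h.prob
  unfold nl
  have := Real.log_nonpos (outDen_pos hq h y).le (outDen_le_one μ y)
  linarith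

lemma nl_le {γ q : ℝ} (hq : 0 < q) {μ : Measure ℝ} (h : Adm γ q μ) (y : ℝ) :
    nl μ y ≤ (Real.log (Real.sqrt (2 * Real.pi)) - Real.log q) + (1 / 2) * y ^ 2 := by
  have h1 := Real.log_le_log (mul_pos hq (gauss_pos y)) (outDen_ge h y)
  rw [Real.log_mul hq.ne' (gauss_pos y).ne', log_gauss] at h1
  unfold nl
  linarith

lemma nl_cont {γ q : ℝ} (hq : 0 < q) {μ : Measure ℝ} (h : Adm γ q μ) : Continuous (nl μ) := by
  have := h.prob
  exact ((outDen_cont μ).log fun y => (outDen_pos hq h y).ne').neg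

lemma nl_qg {γ q : ℝ} (hq : 0 < q) {μ : Measure ℝ} (h : Adm γ q μ) : QG (nl μ) := by
  refine ⟨nl_cont hq h, Real.log (Real.sqrt (2 * Real.pi)) - Real.log q, 1 / 2, fun y => ?_⟩
  rw [abs_of_nonneg (nl_nonneg hq h y)]
  exact nl_le hq h y

lemma one_qg : QG (fun _ => 1) := ⟨by fun_prop, 1, 0, by simp⟩

lemma quad_qg (A B : ℝ) : QG (fun y => A + B * y ^ 2) := by
  refine ⟨by fun_prop, |A|, |B|, fun y => ?_⟩
  refine (abs_add_le _ _).trans ?_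
  rw [abs_mul, abs_of_nonneg (sq_nonneg y)]

lemma log_gauss_qg : QG (fun y => Real.log (gauss y)) := by
  have := quad_qg (-Real.log (Real.sqrt (2 * Real.pi))) (-1 / 2)
  convert this using 2 with y
  rw [log_gauss]; ring

lemma outDen_integrable {γ q : ℝ} {μ : Measure ℝ} (h : Adm γ q μ) : Integrable (outDen μ) := by
  have := h.prob
  simpa using one_qg.out_integrable μ h.int

lemma outDen_integral {γ q : ℝ} {μ : Measure ℝ} (h : Adm γ q μ) : ∫ y, outDen μ y = 1 := by
  have := h.prob
  have h2 := one_qg.smo_integral μ h.int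
  simp [smo, gauss_integral] at h2
  exact h2.symm

/-- differential entropy of the noise -/
noncomputable def hN : ℝ := 1 / 2 + Real.log (Real.sqrt (2 * Real.pi))

lemma relEnt_eq {γ q : ℝ} (hq : 0 < q) {μ : Measure ℝ} (h : Adm γ q μ) (x : ℝ) :
    relEnt x μ = smo (nl μ) x - hN := by
  have e : ∀ y, gauss (y - x) * Real.log (gauss (y - x) / outDen μ y) =
      gauss (y - x) * Real.log (gauss (y - x)) + gauss (y - x) * nl μ y := by
    intro y
    rw [Real.log_div (gauss_pos _).ne' (outDen_pos hq h y).ne', nl]; ring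
  have hi0 : Integrable (fun y => gauss y * Real.log (gauss y)) := by
    simpa using log_gauss_qg.integrable 0
  have hi : Integrable (fun y => gauss (y - x) * Real.log (gauss (y - x))) := hi0.comp_sub_right x
  have hv : ∫ y, gauss (y - x) * Real.log (gauss (y - x)) = -hN := by
    rw [integral_sub_right_eq_self (fun y => gauss y * Real.log (gauss y)) x]
    have := quad_integral (-Real.log (Real.sqrt (2 * Real.pi))) (-1 / 2) 0
    simp only [sub_zero] at this
    rw [hN, show -(1 / 2 + Real.log (Real.sqrt (2 * Real.pi))) =
      -Real.log (Real.sqrt (2 * Real.pi)) + -1 / 2 * (1 + 0 ^ 2) by ring, ← this]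
    congr 1; ext y; rw [log_gauss]; ring
  unfold relEnt smo
  simp_rw [e]
  rw [integral_add hi ((nl_qg hq h).integrable x), hv]; ring

lemma mutInfo_eq {γ q : ℝ} (hq : 0 < q) {μ : Measure ℝ} (h : Adm γ q μ) :
    mutInfo μ = ∫ x, smo (nl μ) x ∂μ - hN := by
  have := h.prob
  unfold mutInfo
  simp_rw [relEnt_eq hq h]
  rw [integral_sub ((nl_qg hq h).smo_integrable μ h.int) (integrable_const _)]
  simp

/-- Gibbs inequality -/
lemma gibbs {p g : ℝ → ℝ} (hp : ∀ y, 0 < p y) (hg : ∀ y, 0 < g y) (ip : Integrable p)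
    (ig : Integrable g) (hpg : ∫ y, g y ≤ ∫ y, p y)
    (i1 : Integrable (fun y => p y * -Real.log (p y)))
    (i2 : Integrable (fun y => p y * -Real.log (g y))) :
    ∫ y, p y * -Real.log (p y) ≤ ∫ y, p y * -Real.log (g y) := by
  have h : ∀ y, p y * -Real.log (p y) ≤ p y * -Real.log (g y) + (g y - p y) := by
    intro y
    have h1 := Real.log_le_sub_one_of_pos (div_pos (hg y) (hp y))
    rw [Real.log_div (hg y).ne' (hp y).ne'] at h1
    have h2 := mul_le_mul_of_nonneg_left h1 (hp y).le
    have h3 : p y * (g y / p y - 1) = g y - p y := by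
      have := (hp y).ne'
      field_simp
    linarith
  have h2 := integral_mono i1 (i2.add (ig.sub ip)) h
  rw [integral_add' i2 (ig.sub ip), integral_sub' ig ip] at h2
  linarith

lemma gibbs_adm {γ q : ℝ} (hq : 0 < q) {μ ν : Measure ℝ} (h : Adm γ q μ) (h' : Adm γ q ν) :
    ∫ x, smo (nl μ) x ∂μ ≤ ∫ x, smo (nl ν) x ∂μ := by
  have := h.prob
  rw [(nl_qg hq h).smo_integral μ h.int, (nl_qg hq h').smo_integral μ h.int]
  refine gibbs (outDen_pos hq h) (outDen_pos hq h') (outDen_integrable h) (outDen_integrable h')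
    ?_ ((nl_qg hq h).out_integrable μ h.int) ((nl_qg hq h').out_integrable μ h.int)
  rw [outDen_integral h, outDen_integral h']

/-! ### Mixtures and the first order condition -/

/-- mixture -/
noncomputable def mix (t : ℝ) (μ ν : Measure ℝ) : Measure ℝ :=
  ENNReal.ofReal (1 - t) • μ + ENNReal.ofReal t • ν

lemma mix_prob {t : ℝ} (h0 : 0 ≤ t) (h1 : t ≤ 1) (μ ν : Measure ℝ) [IsProbabilityMeasure μ]
    [IsProbabilityMeasure ν] : IsProbabilityMeasure (mix t μ ν) := by
  refine ⟨?_⟩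
  simp only [mix, Measure.add_apply, Measure.smul_apply, measure_univ, smul_eq_mul, mul_one]
  rw [← ENNReal.ofReal_add (by linarith) h0]
  simp

lemma mix_real {t : ℝ} (h0 : 0 ≤ t) (h1 : t ≤ 1) (μ ν : Measure ℝ) [IsProbabilityMeasure μ]
    [IsProbabilityMeasure ν] (s : Set ℝ) :
    (mix t μ ν).real s = (1 - t) * μ.real s + t * ν.real s := by
  simp only [mix, Measure.real, Measure.add_apply, Measure.smul_apply, smul_eq_mul]
  rw [ENNReal.toReal_add (by finiteness) (by finiteness), ENNReal.toReal_mul, ENNReal.toReal_mul,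
    ENNReal.toReal_ofReal (by linarith), ENNReal.toReal_ofReal h0]

lemma mix_integrable (t : ℝ) {μ ν : Measure ℝ} {f : ℝ → ℝ} (hf : Integrable f μ)
    (hg : Integrable f ν) : Integrable f (mix t μ ν) :=
  (hf.smul_measure ENNReal.ofReal_ne_top).add_measure (hg.smul_measure ENNReal.ofReal_ne_top)

lemma mix_integral {t : ℝ} (h0 : 0 ≤ t) (h1 : t ≤ 1) {μ ν : Measure ℝ} {f : ℝ → ℝ}
    (hf : Integrable f μ) (hg : Integrable f ν) :
    ∫ x, f x ∂(mix t μ ν) = (1 - t) * ∫ x, f x ∂μ + t * ∫ x, f x ∂ν := by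
  rw [mix, integral_add_measure (hf.smul_measure ENNReal.ofReal_ne_top)
    (hg.smul_measure ENNReal.ofReal_ne_top), integral_smul_measure, integral_smul_measure,
    ENNReal.toReal_ofReal (by linarith), ENNReal.toReal_ofReal h0]
  simp

lemma adm_mix {γ q t : ℝ} (h0 : 0 ≤ t) (h1 : t ≤ 1) {μ ν : Measure ℝ} (h : Adm γ q μ)
    (h' : Adm γ q ν) : Adm γ q (mix t μ ν) := by
  have := h.prob
  have := h'.prob
  refine ⟨mix_prob h0 h1 μ ν, ?_, mix_integrable t h.int h'.int, ?_⟩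
  · rw [mix_real h0 h1]
    nlinarith [h.atom, h'.atom]
  · rw [mix_integral h0 h1 h.int h'.int]
    nlinarith [h.pow, h'.pow]

lemma first_order {γ q : ℝ} (hq : 0 < q) {μ₀ μ : Measure ℝ} (h₀ : Adm γ q μ₀)
    (hmax : ∀ μ : Measure ℝ, Adm γ q μ → ∫ x, smo (nl μ) x ∂μ ≤ ∫ x, smo (nl μ₀) x ∂μ₀)
    (h : Adm γ q μ) : ∫ x, smo (nl μ₀) x ∂μ ≤ ∫ x, smo (nl μ₀) x ∂μ₀ := by
  have := h.prob
  have := h₀.prob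
  have key : ∀ t : ℝ, 0 < t → t ≤ 1 →
      ∫ y, outDen μ y * nl (mix t μ₀ μ) y ≤ ∫ x, smo (nl μ₀) x ∂μ₀ := by
    intro t ht0 ht1
    have ha := adm_mix ht0.le ht1 h₀ h
    have hqg := nl_qg hq ha
    have h1 := hmax _ ha
    rw [mix_integral ht0.le ht1 (hqg.smo_integrable μ₀ h₀.int) (hqg.smo_integrable μ h.int)] at h1
    have h2 := gibbs_adm hq h₀ ha
    rw [← hqg.smo_integral μ h.int]
    have h3 : t * ∫ x, smo (nl (mix t μ₀ μ)) x ∂μ ≤ t * ∫ x, smo (nl μ₀) x ∂μ₀ := by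
      nlinarith
    exact le_of_mul_le_mul_left h3 ht0
  rw [(nl_qg hq h₀).smo_integral μ h.int]
  have tt : ∀ n : ℕ, (0 : ℝ) < 1 / ((n : ℝ) + 1) ∧ 1 / ((n : ℝ) + 1) ≤ 1 := by
    intro n
    refine ⟨by positivity, ?_⟩
    rw [div_le_one (by positivity)]
    have : (0 : ℝ) ≤ n := by positivity
    linarith
  have lim : Tendsto (fun n : ℕ => ∫ y, outDen μ y * nl (mix (1 / ((n : ℝ) + 1)) μ₀ μ) y) atTop
      (nhds (∫ y, outDen μ y * nl μ₀ y)) := by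
    refine tendsto_integral_of_dominated_convergence
      (fun y => outDen μ y * ((Real.log (Real.sqrt (2 * Real.pi)) - Real.log q) + (1 / 2) * y ^ 2))
      (fun n => ?_) ?_ (fun n => ?_) ?_
    · have ha := adm_mix (tt n).1.le (tt n).2 h₀ h
      exact ((nl_qg hq ha).out_integrable μ h.int).aestronglyMeasurable
    · exact (quad_qg _ _).out_integrable μ h.int
    · have ha := adm_mix (tt n).1.le (tt n).2 h₀ h
      refine ae_of_all _ fun y => ?_
      rw [Real.norm_of_nonneg (mul_nonneg (outDen_pos hq h y).le (nl_nonneg hq ha y))]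
      exact mul_le_mul_of_nonneg_left (nl_le hq ha y) (outDen_pos hq h y).le
    · refine ae_of_all _ fun y => ?_
      refine Tendsto.const_mul _ ?_
      unfold nl
      refine (Tendsto.log ?_ (outDen_pos hq h₀ y).ne').neg
      have e : ∀ n : ℕ, outDen (mix (1 / ((n : ℝ) + 1)) μ₀ μ) y =
          (1 - 1 / ((n : ℝ) + 1)) * outDen μ₀ y + 1 / ((n : ℝ) + 1) * outDen μ y := fun n =>
        mix_integral (tt n).1.le (tt n).2 (gauss_int_x μ₀ y) (gauss_int_x μ y)
      simp_rw [e]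
      have ht := tendsto_one_div_add_atTop_nhds_zero_nat (𝕜 := ℝ)
      have := ((ht.const_sub 1).mul_const (outDen μ₀ y)).add (ht.mul_const (outDen μ y))
      simpa using this
  exact le_of_tendsto' lim fun n => key _ (tt n).1 (tt n).2

/-! ### Lagrange multiplier -/

lemma adm_three {γ q : ℝ} (hq0 : 0 < q) (hq1 : q < 1) {a b w : ℝ} (hw0 : 0 ≤ w) (hw1 : w ≤ 1)
    (hp : (1 - q) * ((1 - w) * a ^ 2 + w * b ^ 2) ≤ γ) :
    Adm γ q (mix q (mix w (Measure.dirac a) (Measure.dirac b)) (Measure.dirac 0)) := by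
  have i : ∀ c : ℝ, Integrable (fun x : ℝ => x ^ 2) (Measure.dirac c) := fun c =>
    integrable_dirac (by simp)
  have := mix_prob hw0 hw1 (Measure.dirac a) (Measure.dirac b)
  refine ⟨mix_prob hq0.le hq1.le _ _, ?_, mix_integrable _ (mix_integrable _ (i _) (i _)) (i _), ?_⟩
  · rw [mix_real hq0.le hq1.le]
    have h1 : 0 ≤ (mix w (Measure.dirac a) (Measure.dirac b)).real {0} := measureReal_nonneg
    have h2 : (Measure.dirac (0 : ℝ)).real {0} = 1 := by simp [Measure.real]
    rw [h2]
    nlinarith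
  · rw [mix_integral hq0.le hq1.le (mix_integrable _ (i _) (i _)) (i _),
      mix_integral hw0 hw1 (i _) (i _)]
    simpa using hp

lemma int_three {q : ℝ} (hq0 : 0 < q) (hq1 : q < 1) {a b w : ℝ} (hw0 : 0 ≤ w) (hw1 : w ≤ 1)
    (f : ℝ → ℝ) :
    ∫ x, f x ∂(mix q (mix w (Measure.dirac a) (Measure.dirac b)) (Measure.dirac 0)) =
      (1 - q) * ((1 - w) * f a + w * f b) + q * f 0 := by
  have i : ∀ c : ℝ, Integrable f (Measure.dirac c) := fun c => integrable_dirac (by simp)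
  rw [mix_integral hq0.le hq1.le (mix_integrable _ (i _) (i _)) (i _),
      mix_integral hw0 hw1 (i _) (i _)]
  simp

/-- Existence of a Lagrange multiplier. -/
lemma lagrange {γ q : ℝ} (hq0 : 0 < q) (hq1 : q < 1) (hγ : 0 < γ) (f : ℝ → ℝ) (T : ℝ)
    (hf : ∀ μ : Measure ℝ, Adm γ q μ → ∫ x, f x ∂μ ≤ T) :
    ∃ l C : ℝ, 0 ≤ l ∧ l * γ ≤ T - f 0 ∧ (∀ x, f x ≤ C + l * x ^ 2) ∧
      (1 - q) * C + l * γ = T - q * f 0 := by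
  have hq : 0 < 1 - q := by linarith
  set P := γ / (1 - q) with hP
  have hPγ : (1 - q) * P = γ := by rw [hP]; field_simp
  have hP0 : 0 < P := by positivity
  set L := (T - q * f 0) / (1 - q) with hL
  have hLT : (1 - q) * L = T - q * f 0 := by rw [hL]; field_simp
  have two : ∀ a b w : ℝ, 0 ≤ w → w ≤ 1 → (1 - w) * a ^ 2 + w * b ^ 2 ≤ P →
      (1 - w) * f a + w * f b ≤ L := by
    intro a b w hw0 hw1 h
    have h1 := hf _ (adm_three (γ := γ) hq0 hq1 hw0 hw1 (by rw [← hPγ]; gcongr))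
    rw [int_three hq0 hq1 hw0 hw1] at h1
    have h2 : (1 - q) * ((1 - w) * f a + w * f b) ≤ (1 - q) * L := by linarith
    exact le_of_mul_le_mul_left h2 hq
  have one : ∀ a : ℝ, a ^ 2 ≤ P → f a ≤ L := by
    intro a ha
    have := two a a 0 le_rfl zero_le_one (by linarith)
    linarith
  let S : Set ℝ := (fun a => (L - f a) / (P - a ^ 2)) '' {a | a ^ 2 < P}
  have hbd : ∀ s ∈ S, 0 ≤ s := by
    rintro _ ⟨a, ha, rfl⟩
    exact div_nonneg (by linarith [one a (le_of_lt ha)]) (by linarith [Set.mem_ofPred_eq ▸ ha])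
  have h0S : (L - f 0) / P ∈ S := ⟨0, by simpa using hP0, by simp⟩
  have hbb : BddBelow S := ⟨0, hbd⟩
  refine ⟨sInf S, L - sInf S * P, Real.sInf_nonneg hbd, ?_, ?_, ?_⟩
  · have h1 := csInf_le hbb h0S
    rw [le_div_iff₀ hP0] at h1
    have h2 := mul_le_mul_of_nonneg_left h1 hq.le
    calc sInf S * γ = (1 - q) * (sInf S * P) := by rw [← hPγ]; ring
      _ ≤ (1 - q) * (L - f 0) := h2
      _ = T - f 0 := by rw [mul_sub, hLT]; ring
  · intro x
    rcases lt_trichotomy (x ^ 2) P with hx | hx | hx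
    · have h1 := csInf_le hbb ⟨x, hx, rfl⟩
      simp only at h1
      rw [le_div_iff₀ (by linarith)] at h1
      linarith
    · rw [hx]; linarith [one x hx.le]
    · have h1 : (f x - L) / (x ^ 2 - P) ≤ sInf S := by
        refine le_csInf ⟨_, h0S⟩ ?_
        rintro _ ⟨a, ha, rfl⟩
        have ha' : a ^ 2 < P := ha
        have hd : 0 < x ^ 2 - a ^ 2 := by linarith
        simp only
        rw [div_le_div_iff₀ (by linarith) (by linarith)]
        have h2 := two a x ((P - a ^ 2) / (x ^ 2 - a ^ 2)) (div_nonneg (by linarith) hd.le)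
          (by rw [div_le_one hd]; linarith) (le_of_eq (by field_simp; ring))
        have h3 : (1 - (P - a ^ 2) / (x ^ 2 - a ^ 2)) * f a + (P - a ^ 2) / (x ^ 2 - a ^ 2) * f x =
          ((x ^ 2 - P) * f a + (P - a ^ 2) * f x) / (x ^ 2 - a ^ 2) := by field_simp; ring
        rw [h3, div_le_iff₀ hd] at h2
        linarith
      rw [div_le_iff₀ (by linarith)] at h1
      linarith
  · calc _ = (1 - q) * L - sInf S * ((1 - q) * P) + sInf S * γ := by ring
      _ = _ := by rw [hPγ, hLT]; ring

/-! ### Bound on the multiplier -/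

lemma dirac_adm {γ q : ℝ} (hq1 : q < 1) (hγ : 0 < γ) : Adm γ q (Measure.dirac 0) := by
  refine ⟨inferInstance, ?_, integrable_dirac (by simp), ?_⟩
  · have h2 : (Measure.dirac (0 : ℝ)).real {0} = 1 := by simp [Measure.real]
    rw [h2]; exact hq1.le
  · simpa using hγ.le

lemma smo_zero_ge {γ q : ℝ} (hq : 0 < q) (hq1 : q < 1) (hγ : 0 < γ) {μ : Measure ℝ}
    (h : Adm γ q μ) : hN ≤ smo (nl μ) 0 := by
  have h1 := gibbs_adm hq (dirac_adm (γ := γ) hq1 hγ) h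
  simp only [integral_dirac] at h1
  refine le_trans (le_of_eq ?_) h1
  have e : ∀ y, nl (Measure.dirac 0) y = Real.log (Real.sqrt (2 * Real.pi)) + 1 / 2 * y ^ 2 := by
    intro y
    simp only [nl, outDen, integral_dirac, sub_zero, log_gauss]
    ring
  unfold smo
  simp_rw [e]
  rw [quad_integral, hN]; ring

lemma entropy_le {γ q : ℝ} (hq : 0 < q) (hγ : 0 < γ) {μ : Measure ℝ}
    (h : Adm γ q μ) : ∫ x, smo (nl μ) x ∂μ ≤ hN + Real.log (1 + γ) / 2 := by
  have := h.prob
  have hv : (0 : ℝ) < 1 + γ := by linarith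
  set v : NNReal := ⟨1 + γ, hv.le⟩ with hvdef
  have hv0 : v ≠ 0 := by
    intro h0
    have : (v : ℝ) = 0 := by rw [h0]; rfl
    have h2 : (v : ℝ) = 1 + γ := rfl
    linarith
  have hvc : (v : ℝ) = 1 + γ := rfl
  have e : ∀ y, -Real.log (ProbabilityTheory.gaussianPDFReal 0 v y) =
      (Real.log (Real.sqrt (2 * Real.pi)) + Real.log (1 + γ) / 2) +
        (1 / (2 * (1 + γ))) * y ^ 2 := by
    intro y
    rw [ProbabilityTheory.gaussianPDFReal, Real.log_mul (by positivity) (by positivity),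
      Real.log_exp, Real.log_inv, hvc, Real.sqrt_mul (by positivity), Real.log_mul (by positivity)
      (by positivity), Real.log_sqrt hv.le]
    field_simp
    ring
  rw [(nl_qg hq h).smo_integral μ h.int]
  have hg := gibbs (p := outDen μ) (g := ProbabilityTheory.gaussianPDFReal 0 v) (outDen_pos hq h)
    (fun y => ProbabilityTheory.gaussianPDFReal_pos 0 v y hv0) (outDen_integrable h)
    (ProbabilityTheory.integrable_gaussianPDFReal 0 v)
    (by rw [outDen_integral h, ProbabilityTheory.integral_gaussianPDFReal_eq_one 0 hv0])
    ((nl_qg hq h).out_integrable μ h.int)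
    (by simp_rw [e]; exact (quad_qg _ _).out_integrable μ h.int)
  refine hg.trans ?_
  simp_rw [e]
  rw [← (quad_qg _ _).smo_integral μ h.int]
  unfold smo
  simp_rw [quad_integral]
  have hi : Integrable (fun x : ℝ => 1 + x ^ 2) μ := (integrable_const _).add h.int
  rw [integral_add (integrable_const _) (hi.const_mul _),
    integral_const_mul, integral_add (integrable_const _) h.int]
  simp only [integral_const, probReal_univ, smul_eq_mul, one_mul]
  have h1 : 1 / (2 * (1 + γ)) * (1 + ∫ x, x ^ 2 ∂μ) ≤ 1 / 2 := by
    calc _ ≤ 1 / (2 * (1 + γ)) * (1 + γ) := by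
          have := h.pow
          gcongr
      _ = 1 / 2 := by field_simp
  rw [hN]; linarith

lemma mult_lt {γ q : ℝ} (hq : 0 < q) (hq1 : q < 1) (hγ : 0 < γ) {μ : Measure ℝ}
    (h : Adm γ q μ) {l : ℝ} (hl : l * γ ≤ ∫ x, smo (nl μ) x ∂μ - smo (nl μ) 0) : l < 1 / 2 := by
  have h1 := entropy_le hq hγ h
  have h2 := smo_zero_ge hq hq1 hγ h
  have h3 := Real.log_lt_sub_one_of_pos (show 0 < 1 + γ by linarith) (by linarith)
  have h4 : l * γ < 1 / 2 * γ := by linarith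
  exact lt_of_mul_lt_mul_right h4 hγ.le

/-! ### Moment generating functions -/

open ProbabilityTheory in
lemma ext_mgf {κ κ' : Measure ℝ} [IsFiniteMeasure κ] [IsFiniteMeasure κ']
    (hi : ∀ t, Integrable (fun x => Real.exp (t * x)) κ) (h : mgf id κ = mgf id κ') : κ = κ' := by
  have h0 : κ.real Set.univ = κ'.real Set.univ := by
    have := congrFun h 0
    simpa [mgf] using this
  have hz : κ = 0 ↔ κ' = 0 := by
    rw [← Measure.measure_univ_eq_zero, ← Measure.measure_univ_eq_zero, ← measureReal_eq_zero_iff,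
      ← measureReal_eq_zero_iff, h0]
  have hs : integrableExpSet id κ = Set.univ := Set.eq_univ_of_forall hi
  have := eqOn_complexMGF_of_mgf' h hz
  apply Measure.ext_of_complexMGF_id_eq
  ext z
  apply this
  simp [hs]

/-- weighted measure -/
noncomputable def wm (u : ℝ → ℝ) : Measure ℝ :=
  volume.withDensity fun y => ENNReal.ofReal (gauss y * u y)

lemma gauss_shift (x y : ℝ) : gauss (y - x) = Real.exp (-x ^ 2 / 2) * (gauss y * Real.exp (x * y)) := by
  unfold gauss
  rw [show -(y - x) ^ 2 / 2 = -x ^ 2 / 2 + (-y ^ 2 / 2 + x * y) by ring, Real.exp_add, Real.exp_add]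
  ring

lemma wm_meas {u : ℝ → ℝ} (hu : QG u) : Measurable fun y => ENNReal.ofReal (gauss y * u y) :=
  (gauss_cont.mul hu.1).measurable.ennreal_ofReal

lemma wm_finite {u : ℝ → ℝ} (hu : QG u) : IsFiniteMeasure (wm u) := by
  have := hu.integrable 0
  simp only [sub_zero] at this
  exact isFiniteMeasure_withDensity_ofReal this.2

lemma wm_exp {u : ℝ → ℝ} (hu : QG u) (h0 : ∀ y, 0 ≤ u y) (x : ℝ) :
    Integrable (fun y => Real.exp (x * y)) (wm u) := by
  rw [wm, integrable_withDensity_iff_integrable_smul' (wm_meas hu) (ae_of_all _ fun _ => by simp)]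
  have := (hu.integrable x).const_mul (Real.exp (x ^ 2 / 2))
  refine this.congr (ae_of_all _ fun y => ?_)
  simp only [smul_eq_mul]
  rw [ENNReal.toReal_ofReal (mul_nonneg (gauss_pos y).le (h0 y)), gauss_shift]
  have : Real.exp (x ^ 2 / 2) * Real.exp (-x ^ 2 / 2) = 1 := by
    rw [← Real.exp_add]; ring_nf; simp
  linear_combination (gauss y * Real.exp (x * y) * u y) * this

lemma wm_mgf {u : ℝ → ℝ} (hu : QG u) (h0 : ∀ y, 0 ≤ u y) (x : ℝ) :
    smo u x = Real.exp (-x ^ 2 / 2) * ProbabilityTheory.mgf id (wm u) x := by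
  rw [ProbabilityTheory.mgf, wm, integral_withDensity_eq_integral_toReal_smul (wm_meas hu)
    (ae_of_all _ fun _ => by simp), ← integral_const_mul]
  unfold smo
  congr 1
  ext y
  simp only [smul_eq_mul, id]
  rw [ENNReal.toReal_ofReal (mul_nonneg (gauss_pos y).le (h0 y)), gauss_shift]
  ring

lemma smo_analytic {u : ℝ → ℝ} (hu : QG u) (h0 : ∀ y, 0 ≤ u y) :
    AnalyticOnNhd ℝ (smo u) Set.univ := by
  have e : smo u = fun x => Real.exp (-x ^ 2 / 2) * ProbabilityTheory.mgf id (wm u) x := by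
    ext x; exact wm_mgf hu h0 x
  rw [e]
  intro x _
  have hs : ProbabilityTheory.integrableExpSet id (wm u) = Set.univ :=
    Set.eq_univ_of_forall (wm_exp hu h0)
  have := ProbabilityTheory.analyticAt_mgf (X := id) (μ := wm u) (t := x) (by simp [hs])
  refine AnalyticAt.mul ?_ this
  fun_prop

lemma smo_inj {u v : ℝ → ℝ} (hu : QG u) (h0 : ∀ y, 0 ≤ u y) (hv : QG v) (h0' : ∀ y, 0 ≤ v y)
    (h : ∀ x, smo u x = smo v x) : u = v := by
  have := wm_finite hu
  have := wm_finite hv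
  have hm : wm u = wm v := by
    refine ext_mgf (wm_exp hu h0) ?_
    ext x
    have := h x
    rw [wm_mgf hu h0, wm_mgf hv h0'] at this
    exact mul_left_cancel₀ (Real.exp_pos _).ne' this
  have hfin : ∫⁻ y, ENNReal.ofReal (gauss y * u y) ≠ ⊤ := by
    have := measure_ne_top (wm u) Set.univ
    simpa [wm] using this
  rw [wm, wm, withDensity_eq_iff (wm_meas hu).aemeasurable (wm_meas hv).aemeasurable hfin] at hm
  have hae : u =ᵐ[volume] v := by
    filter_upwards [hm] with y hy
    rw [ENNReal.ofReal_eq_ofReal_iff (mul_nonneg (gauss_pos y).le (h0 y))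
      (mul_nonneg (gauss_pos y).le (h0' y))] at hy
    exact mul_left_cancel₀ (gauss_pos y).ne' hy
  exact (Continuous.ae_eq_iff_eq volume hu.1 hv.1).1 hae

/-! ### The two contradictions -/

lemma not_quadratic {γ q : ℝ} (hq : 0 < q) {μ : Measure ℝ} (h : Adm γ q μ) {l C : ℝ}
    (hl0 : 0 ≤ l) (hl : l < 1 / 2) (hx : ∀ x, smo (nl μ) x = C + l * x ^ 2) : False := by
  have := h.prob
  have hnl : ∀ y, nl μ y = (C - l) + l * y ^ 2 := by
    obtain ⟨hc, A, B, hb⟩ := nl_qg hq h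
    have q1 : QG (fun y => |C - l| + nl μ y) := by
      refine ⟨continuous_const.add hc, |C - l| + A, B, fun y => ?_⟩
      refine (abs_add_le _ _).trans ?_
      rw [abs_abs]
      linarith [hb y]
    have := smo_inj q1 (fun y => add_nonneg (abs_nonneg _) (nl_nonneg hq h y))
      (quad_qg (|C - l| + (C - l)) l)
      (fun y => by nlinarith [neg_abs_le (C - l), mul_nonneg hl0 (sq_nonneg y)]) (fun x => by
        have h1 : smo (fun y => |C - l| + nl μ y) x = |C - l| + smo (nl μ) x := by
          unfold smo
          simp_rw [mul_add]
          rw [integral_add ((gauss_integrable x).mul_const _) ((nl_qg hq h).integrable x),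
            integral_mul_const, gauss_integral, one_mul]
        rw [h1, hx, smo, quad_integral]; ring)
    intro y
    have := congrFun this y
    linarith
  have hout : ∀ y, outDen μ y = Real.exp (-(C - l)) * Real.exp (-l * y ^ 2) := by
    intro y
    rw [← Real.exp_add, ← Real.exp_log (outDen_pos hq h y)]
    congr 1
    have := hnl y
    unfold nl at this
    linarith
  set v : NNReal := ⟨1 - 2 * l, by linarith⟩ with hv
  have hvc : (v : ℝ) = 1 - 2 * l := rfl
  have hv0 : v ≠ 0 := by
    intro h0
    have : (v : ℝ) = 0 := by rw [h0]; rfl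
    linarith
  set A := Real.sqrt (2 * Real.pi) * Real.exp (-(C - l)) with hA
  have hA0 : 0 ≤ A := by positivity
  have hmeas : Measurable fun x : ℝ => ENNReal.ofReal (Real.exp (-x ^ 2 / 2)) := by fun_prop
  have hfin : IsFiniteMeasure (μ.withDensity fun x => ENNReal.ofReal (Real.exp (-x ^ 2 / 2))) := by
    refine isFiniteMeasure_withDensity_ofReal (Integrable.hasFiniteIntegral ?_)
    refine (integrable_const (1 : ℝ)).mono' (by fun_prop) (ae_of_all _ fun x => ?_)
    rw [Real.norm_of_nonneg (Real.exp_pos _).le, Real.exp_le_one_iff]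
    nlinarith [sq_nonneg x]
  have hfin2 : IsFiniteMeasure (ENNReal.ofReal A • ProbabilityTheory.gaussianReal 0 v) :=
    Measure.smul_finite _ ENNReal.ofReal_ne_top
  have hext : ENNReal.ofReal A • ProbabilityTheory.gaussianReal 0 v =
      μ.withDensity fun x => ENNReal.ofReal (Real.exp (-x ^ 2 / 2)) := by
    refine ext_mgf (fun t => ?_) ?_
    · exact (ProbabilityTheory.integrable_exp_mul_gaussianReal t).smul_measure ENNReal.ofReal_ne_top
    · ext y
      have h1 : ProbabilityTheory.mgf id (ENNReal.ofReal A • ProbabilityTheory.gaussianReal 0 v) y =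
          A * Real.exp ((1 - 2 * l) * y ^ 2 / 2) := by
        have := congrFun (ProbabilityTheory.mgf_id_gaussianReal (μ := 0) (v := v)) y
        unfold ProbabilityTheory.mgf at this ⊢
        rw [integral_smul_measure, this, ENNReal.toReal_ofReal hA0, hvc]
        simp
      rw [h1, ProbabilityTheory.mgf, integral_withDensity_eq_integral_toReal_smul hmeas
        (ae_of_all _ fun _ => by simp)]
      have h2 : ∀ x : ℝ, (ENNReal.ofReal (Real.exp (-x ^ 2 / 2))).toReal • Real.exp (y * id x) =
          (Real.sqrt (2 * Real.pi) * Real.exp (y ^ 2 / 2)) * gauss (y - x) := by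
        intro x
        rw [ENNReal.toReal_ofReal (Real.exp_pos _).le, smul_eq_mul, id, gauss,
          show -(y - x) ^ 2 / 2 = -x ^ 2 / 2 + (y * x - y ^ 2 / 2) by ring, Real.exp_add,
          Real.exp_sub]
        have : Real.sqrt (2 * Real.pi) ≠ 0 := by positivity
        field_simp
      simp_rw [h2]
      rw [integral_const_mul]
      change _ = _ * outDen μ y
      rw [hout, hA, show (1 - 2 * l) * y ^ 2 / 2 = y ^ 2 / 2 + -l * y ^ 2 by ring, Real.exp_add]
      ring
  have hz := congrArg (fun κ : Measure ℝ => κ {0}) hext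
  simp only [Measure.smul_apply] at hz
  have := ProbabilityTheory.nullSingletonClass_gaussianReal (μ := 0) hv0
  rw [measure_singleton, withDensity_apply _ (measurableSet_singleton 0), lintegral_singleton] at hz
  simp at hz
  have hat := h.atom
  simp [Measure.real, ← hz] at hat
  linarith

lemma not_bounded {γ q : ℝ} (hq : 0 < q) {μ : Measure ℝ} (h : Adm γ q μ) {l C M : ℝ}
    (hl : l < 1 / 2) (hx : ∀ x, smo (nl μ) x ≤ C + l * x ^ 2)
    (hM : ∀ᵐ x ∂μ, |x| ≤ M) : False := by
  have := h.prob
  have hout : ∀ y, outDen μ y ≤ gauss y * Real.exp (M * |y|) := by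
    intro y
    have : ∫ x, gauss (y - x) ∂μ ≤ ∫ _, gauss y * Real.exp (M * |y|) ∂μ := by
      refine integral_mono_ae (gauss_int_x μ y) (integrable_const _) ?_
      filter_upwards [hM] with x hx
      rw [gauss_shift]
      have h1 : Real.exp (-x ^ 2 / 2) ≤ 1 := by
        rw [Real.exp_le_one_iff]; nlinarith [sq_nonneg x]
      have h2 : x * y ≤ M * |y| := by
        calc x * y ≤ |x * y| := le_abs_self _
          _ = |x| * |y| := abs_mul _ _
          _ ≤ M * |y| := by gcongr
      have h3 := Real.exp_le_exp.2 h2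
      have h4 := mul_le_mul_of_nonneg_left h3 (gauss_pos y).le
      calc _ ≤ 1 * (gauss y * Real.exp (x * y)) :=
            mul_le_mul_of_nonneg_right h1 (mul_nonneg (gauss_pos y).le (Real.exp_pos _).le)
        _ ≤ _ := by rw [one_mul]; exact h4
    simpa [outDen] using this
  set e := (1 / 2 - l) / 2 with he
  have he0 : 0 < e := by rw [he]; linarith
  have hnl : ∀ y, -(M ^ 2 / (4 * e)) + (1 / 2 - e) * y ^ 2 ≤ nl μ y := by
    intro y
    have h1 := Real.log_le_log (outDen_pos hq h y) (hout y)
    rw [Real.log_mul (gauss_pos y).ne' (Real.exp_pos _).ne', log_gauss, Real.log_exp] at h1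
    have h2 : M * |y| ≤ e * y ^ 2 + M ^ 2 / (4 * e) := by
      have h3 : e * y ^ 2 + M ^ 2 / (4 * e) - M * |y| = (2 * e * |y| - M) ^ 2 / (4 * e) := by
        rw [← sq_abs y]; field_simp; ring
      have h4 : 0 ≤ (2 * e * |y| - M) ^ 2 / (4 * e) := by positivity
      linarith
    have := log_sqrt_nonneg
    unfold nl
    linarith
  have hf : ∀ x, e * x ^ 2 ≤ C + M ^ 2 / (4 * e) - (1 / 2 - e) := by
    intro x
    have h1 : smo (fun y => -(M ^ 2 / (4 * e)) + (1 / 2 - e) * y ^ 2) x ≤ smo (nl μ) x :=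
      integral_mono (quad_integrable _ _ x) ((nl_qg hq h).integrable x) fun y =>
        mul_le_mul_of_nonneg_left (hnl y) (gauss_pos _).le
    rw [smo, quad_integral] at h1
    have h2 := hx x
    have h3 : l = 1 / 2 - 2 * e := by rw [he]; ring
    rw [h3] at h2
    linarith
  set D := C + M ^ 2 / (4 * e) - (1 / 2 - e)
  have h1 := hf (Real.sqrt ((|D| + 1) / e))
  rw [Real.sq_sqrt (by positivity), mul_div_cancel₀ _ he0.ne'] at h1
  linarith [le_abs_self D]

lemma ptsIncrease_eq (μ : Measure ℝ) : ptsIncrease μ = μ.support := by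
  rw [Measure.support_eq_forall_isOpen]
  ext x
  simp only [ptsIncrease, Set.mem_ofPred_eq]
  constructor
  · intro h u hx hu
    exact h u hu hx
  · intro h u hu hx
    exact h u hx hu

lemma null_compl (μ : Measure ℝ) : μ (ptsIncrease μ)ᶜ = 0 := by
  rw [ptsIncrease_eq]
  exact Measure.measure_compl_support

lemma touch {γ q : ℝ} (hq0 : 0 < q) {μ₀ : Measure ℝ} (h₀ : Adm γ q μ₀) {f : ℝ → ℝ}
    (hfc : Continuous f) (hfi : Integrable f μ₀) {l C : ℝ} (hl0 : 0 ≤ l)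
    (hle : ∀ x, f x ≤ C + l * x ^ 2)
    (hC : (1 - q) * C + l * γ = ∫ x, f x ∂μ₀ - q * f 0) :
    ∀ x ∈ ptsIncrease μ₀ \ {0}, f x = C + l * x ^ 2 := by
  have := h₀.prob
  set g : ℝ → ℝ := fun x => C + l * x ^ 2 - f x with hg
  have hg0 : ∀ x, 0 ≤ g x := fun x => by have := hle x; simp only [hg]; linarith
  have hgc : Continuous g := by fun_prop
  have i1 : Integrable (fun x : ℝ => C + l * x ^ 2) μ₀ := (integrable_const _).add (h₀.int.const_mul l)
  have hgi : Integrable g μ₀ := i1.sub hfi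
  have hI : ∫ x, g x ∂μ₀ ≤ q * g 0 := by
    have : ∫ x, g x ∂μ₀ = C + l * ∫ x, x ^ 2 ∂μ₀ - ∫ x, f x ∂μ₀ := by
      rw [hg, integral_sub i1 hfi, integral_add (integrable_const _) (h₀.int.const_mul l),
        integral_const_mul]
      simp
    rw [this]
    have h2 := mul_le_mul_of_nonneg_left h₀.pow hl0
    simp only [hg]
    nlinarith
  have hsplit := integral_add_compl (measurableSet_singleton (0 : ℝ)) hgi
  rw [integral_singleton, smul_eq_mul] at hsplit
  have hat := mul_le_mul_of_nonneg_right h₀.atom (hg0 0)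
  have hz : ∫ x in {0}ᶜ, g x ∂μ₀ = 0 :=
    le_antisymm (by linarith) (integral_nonneg hg0)
  rw [integral_eq_zero_iff_of_nonneg hg0 hgi.integrableOn] at hz
  rw [Filter.EventuallyEq, ae_restrict_iff' (measurableSet_singleton (0 : ℝ)).compl] at hz
  rintro x ⟨hx, hx0⟩
  by_contra hne
  have hne' : g x ≠ 0 := by
    simp only [hg]
    intro h
    exact hne (by linarith)
  have hpos := hx ({y | g y ≠ 0} ∩ {0}ᶜ) ((isOpen_ne_fun hgc continuous_const).inter
    isOpen_compl_singleton) ⟨hne', hx0⟩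
  have hzero : μ₀ ({y | g y ≠ 0} ∩ {0}ᶜ) = 0 := by
    refine measure_mono_null ?_ (ae_iff.1 hz)
    rintro y ⟨hy, hy0⟩
    simp only [Set.mem_ofPred_eq, Classical.not_imp]
    exact ⟨hy0, hy⟩
  exact hpos.ne' hzero

/-- the set of points of increase of the unique maximizer `μ₀` of `I` over
`Λ(γ,q)` is countably infinite, its intersection with every bounded interval is finite, and
`μ₀` is discrete (concentrated on this countable set of mass points). -/
theorem maximizer_discrete_infinite_support (q γ : ℝ) (hq0 : 0 < q) (hq1 : q < 1) (hγ : 0 < γ)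
    (μ₀ : Measure ℝ) (h₀ : memLam γ q μ₀)
    (hmax : ∀ μ : Measure ℝ, memLam γ q μ → mutInfo μ ≤ mutInfo μ₀)
    (huniq : ∀ μ : Measure ℝ, memLam γ q μ →
      (∀ μ' : Measure ℝ, memLam γ q μ' → mutInfo μ' ≤ mutInfo μ) → μ = μ₀) :
    (ptsIncrease μ₀).Countable ∧ (ptsIncrease μ₀).Infinite ∧
      (∀ a b : ℝ, (ptsIncrease μ₀ ∩ Set.Icc a b).Finite) ∧
      μ₀ (ptsIncrease μ₀)ᶜ = 0 := by
  have H₀ := (adm_iff hγ μ₀).1 h₀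
  have hpr := H₀.prob
  have hmax' : ∀ μ : Measure ℝ, Adm γ q μ →
      ∫ x, smo (nl μ) x ∂μ ≤ ∫ x, smo (nl μ₀) x ∂μ₀ := by
    intro μ hμ
    have := hmax μ ((adm_iff hγ μ).2 hμ)
    rw [mutInfo_eq hq0 hμ, mutInfo_eq hq0 H₀] at this
    linarith
  obtain ⟨l, C, hl0, hlγ, hle, hC⟩ := lagrange hq0 hq1 hγ (smo (nl μ₀)) _
    fun μ hμ => first_order hq0 H₀ hmax' hμ
  have hl := mult_lt hq0 hq1 hγ H₀ hlγ
  have han := smo_analytic (nl_qg hq0 H₀) (nl_nonneg hq0 H₀)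
  have hcont : Continuous (smo (nl μ₀)) := by
    rw [← continuousOn_univ]; exact han.continuousOn
  have ht := touch hq0 H₀ hcont ((nl_qg hq0 H₀).smo_integrable μ₀ H₀.int) hl0 hle hC
  have hfinite : ∀ a b : ℝ, (ptsIncrease μ₀ ∩ Set.Icc a b).Finite := by
    intro a b
    by_contra hinf
    have hinf' : ((ptsIncrease μ₀ ∩ Set.Icc a b) \ {0}).Infinite :=
      Set.Infinite.sdiff hinf (Set.finite_singleton 0)
    obtain ⟨z, -, hz⟩ := hinf'.exists_accPt_of_subset_isCompact (isCompact_Icc (a := a) (b := b))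
      (fun x hx => hx.1.2)
    rw [accPt_iff_frequently_nhdsNE] at hz
    have heq := han.eq_of_frequently_eq (g := fun x => C + l * x ^ 2) (z₀ := z)
      (fun x _ => by fun_prop) (hz.mono fun x hx => ht x ⟨hx.1.1, hx.2⟩)
    exact not_quadratic hq0 H₀ hl0 hl (fun x => congrFun heq x)
  refine ⟨?_, ?_, hfinite, null_compl μ₀⟩
  · have : ptsIncrease μ₀ ⊆ ⋃ n : ℕ, ptsIncrease μ₀ ∩ Set.Icc (-(n : ℝ)) n := by
      intro x hx
      obtain ⟨n, hn⟩ := exists_nat_ge |x|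
      exact Set.mem_iUnion.2 ⟨n, hx, abs_le.1 hn⟩
    exact (Set.countable_iUnion fun n => (hfinite _ _).countable).mono this
  · intro hfin
    obtain ⟨M, hM⟩ := hfin.isBounded.exists_norm_le
    refine not_bounded hq0 H₀ hl hle (M := M) ?_
    have : ∀ᵐ x ∂μ₀, x ∈ ptsIncrease μ₀ := null_compl μ₀
    filter_upwards [this] with x hx
    exact hM x hx
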